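/- arXiv:math/9201215 — 4 statements merged into one kernel-verified Lean document; each statement's English description precedes it below -/
import Mathlib

section
/- Let E and F be Banach spaces and let T : E → F be a bounded linear operator. Then T is 1-summing if and only if there exist a Banach space F₁ and a linear isometric embedding φ : F → F₁ such that the composition φ∘T : E → F₁ is an integral operator. -/
set_option maxHeartbeats 1000000
set_option synthInstance.maxHeartbeats 400000
set_option maxSynthPendingDepth 3

noncomputable section

open scoped BigOperators NNReal ENNReal
open NormedSpace

/-- The scalar field. -/
notation "𝕂" => ℝ

section Summing

variable {E F : Type} [NormedAddCommGroup E] [NormedSpace 𝕂 E]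
  [NormedAddCommGroup F] [NormedSpace 𝕂 F]

/-- The weak ℓ_q norm of a finite family of vectors:
`sup { (Σ_i ‖e*(e_i)‖^q)^(1/q) : e* ∈ E*, ‖e*‖ ≤ 1 }`. -/
def weakNorm (q : ℝ) {n : ℕ} (e : Fin n → E) : ℝ :=
  ⨆ f : {f : StrongDual 𝕂 E // ‖f‖ ≤ 1}, (∑ i, ‖(f : StrongDual 𝕂 E) (e i)‖ ^ q) ^ (1 / q)

/-- `T` satisfies the (p,q)-summing inequality with constant `C`:
`(Σ_i ‖T e_i‖^p)^(1/p) ≤ C · sup { (Σ_i ‖e*(e_i)‖^q)^(1/q) : ‖e*‖ ≤ 1 }`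
for all finite families `e_1, …, e_n`. -/
def SummingWithC (p q C : ℝ) (T : E →L[𝕂] F) : Prop :=
  ∀ (n : ℕ) (e : Fin n → E),
    (∑ i, ‖T (e i)‖ ^ p) ^ (1 / p) ≤ C * weakNorm q e

/-- `T` is (p,q)-summing. -/
def IsPQSumming (p q : ℝ) (T : E →L[𝕂] F) : Prop :=
  ∃ C, 0 ≤ C ∧ SummingWithC p q C T

/-- `T` is p-summing. -/
def IsPSumming (p : ℝ) (T : E →L[𝕂] F) : Prop := IsPQSumming p p T

/-- The p-summing norm `π_p(T)`: the least admissible constant. -/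
def pNorm (p : ℝ) (T : E →L[𝕂] F) : ℝ :=
  sInf {C | 0 ≤ C ∧ SummingWithC p p C T}

end Summing

section Eps

variable {X Y : Type} [NormedAddCommGroup X] [NormedSpace 𝕂 X]
  [NormedAddCommGroup Y] [NormedSpace 𝕂 Y]

/-- The rank-one operator `x* ↦ x*(x) • y`, realizing the elementary tensor `x ⊗ y`
inside the space of operators from `X*` to `Y`. -/
def elemTensor (x : X) (y : Y) : StrongDual 𝕂 X →L[𝕂] Y :=
  (inclusionInDoubleDual 𝕂 X x).smulRight y

/-- The injective tensor product `X ⊗̂_ε Y`, as a submodule of the operators `X* → Y`: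
the closure of the span of the elementary tensors.  (The operator norm of
`x* ↦ Σ_i x*(x_i) • y_i` is exactly the injective tensor norm of `Σ_i x_i ⊗ y_i`.) -/
def epsSub (X Y : Type) [NormedAddCommGroup X] [NormedSpace 𝕂 X]
    [NormedAddCommGroup Y] [NormedSpace 𝕂 Y] : Submodule 𝕂 (StrongDual 𝕂 X →L[𝕂] Y) :=
  (Submodule.span 𝕂 (Set.range fun p : X × Y => elemTensor p.1 p.2)).topologicalClosure

/-- The injective tensor product `X ⊗̂_ε Y` as a normed space. -/
def EpsTensor (X Y : Type) [NormedAddCommGroup X] [NormedSpace 𝕂 X]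
    [NormedAddCommGroup Y] [NormedSpace 𝕂 Y] : Type := ↥(epsSub X Y)

instance : NormedAddCommGroup (EpsTensor X Y) :=
  inferInstanceAs (NormedAddCommGroup ↥(epsSub X Y))

instance : NormedSpace 𝕂 (EpsTensor X Y) :=
  inferInstanceAs (NormedSpace 𝕂 ↥(epsSub X Y))

instance [CompleteSpace Y] : CompleteSpace (EpsTensor X Y) := by
  have h : IsClosed ((epsSub X Y : Submodule 𝕂 (StrongDual 𝕂 X →L[𝕂] Y)) : Set (StrongDual 𝕂 X →L[𝕂] Y)) := by
    unfold epsSub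
    exact Submodule.isClosed_topologicalClosure _
  exact h.completeSpace_coe

/-- The elementary tensor `x ⊗ y` as an element of `X ⊗̂_ε Y`. -/
def tmulEps (x : X) (y : Y) : EpsTensor X Y :=
  show ↥(epsSub X Y) from
    ⟨elemTensor x y,
      Submodule.le_topologicalClosure _ (Submodule.subset_span ⟨(x, y), rfl⟩)⟩

/-- For fixed `x : X`, the bounded linear map `y ↦ x ⊗ y` from `Y` to `X ⊗̂_ε Y`. -/
def tmulLeft (x : X) : Y →L[𝕂] EpsTensor X Y :=
  show Y →L[𝕂] ↥(epsSub X Y) from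
    ContinuousLinearMap.codRestrict
      (ContinuousLinearMap.smulRightL 𝕂 (StrongDual 𝕂 X) Y (inclusionInDoubleDual 𝕂 X x))
      (epsSub X Y)
      (fun y => Submodule.le_topologicalClosure _ (Submodule.subset_span ⟨(x, y), rfl⟩))

variable {Z : Type} [NormedAddCommGroup Z] [NormedSpace 𝕂 Z]

/-- The operator `T# x : Y → Z` induced by `T : X ⊗̂_ε Y → Z`, i.e. `(T# x) y = T (x ⊗ y)`. -/
def sharp (T : EpsTensor X Y →L[𝕂] Z) (x : X) : Y →L[𝕂] Z :=
  T.comp (tmulLeft x)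

end Eps

section Integral

variable {E F : Type} [NormedAddCommGroup E] [NormedSpace 𝕂 E]
  [NormedAddCommGroup F] [NormedSpace 𝕂 F]

/-- `Φ ∈ (E ⊗̂_ε F*)*` extends the bilinear form `(e, f) ↦ f (T e)` associated to `T`. -/
def ExtendsOf (T : E →L[𝕂] F) (Φ : StrongDual 𝕂 (EpsTensor E (StrongDual 𝕂 F))) : Prop :=
  ∀ (e : E) (f : StrongDual 𝕂 F), Φ (tmulEps e f) = f (T e)

/-- `T : E → F` is an integral operator: the bilinear form `(e, f) ↦ f(T e)` extends to a
bounded linear functional on `E ⊗̂_ε F*`. -/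
def IsIntegralOp (T : E →L[𝕂] F) : Prop := ∃ Φ, ExtendsOf T Φ

/-- The integral norm `‖T‖_int` of `T`: the norm of the extending functional
(the extension is unique, since the elementary tensors span a dense subspace). -/
def integralNorm (T : E →L[𝕂] F) : ℝ :=
  sInf {c | ∃ Φ, ExtendsOf T Φ ∧ ‖Φ‖ = c}

end Integral

section IntegralSpace

variable (Y Z : Type) [NormedAddCommGroup Y] [NormedSpace 𝕂 Y]
  [NormedAddCommGroup Z] [NormedSpace 𝕂 Z]

/-- The space `I(Y,Z)` of integral operators from `Y` to `Z` with the integral norm,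
realized isometrically as the subspace of `(Y ⊗̂_ε Z*)*` consisting of those functionals
that extend the bilinear form of a (necessarily unique) operator `T : Y → Z`. -/
def IntegralSub : Submodule 𝕂 (StrongDual 𝕂 (EpsTensor Y (StrongDual 𝕂 Z))) where
  carrier := {Φ | ∃ T : Y →L[𝕂] Z, ExtendsOf T Φ}
  add_mem' := by
    rintro Φ Ψ ⟨T, hT⟩ ⟨S, hS⟩
    exact ⟨T + S, fun e f => by
      simp [ExtendsOf, ContinuousLinearMap.add_apply, map_add, hT e f, hS e f]⟩
  zero_mem' := ⟨0, fun e f => by simp⟩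
  smul_mem' := by
    rintro c Φ ⟨T, hT⟩
    exact ⟨c • T, fun e f => by
      simp [ContinuousLinearMap.smul_apply, map_smul, hT e f]⟩

/-- The space `I(Y,Z)` of integral operators with the integral norm, as a normed space. -/
def IntegralSpace : Type := ↥(IntegralSub Y Z)

instance : NormedAddCommGroup (IntegralSpace Y Z) :=
  inferInstanceAs (NormedAddCommGroup ↥(IntegralSub Y Z))

instance : NormedSpace 𝕂 (IntegralSpace Y Z) :=
  inferInstanceAs (NormedSpace 𝕂 ↥(IntegralSub Y Z))

variable {Y Z}

/-- The functional in `(Y ⊗̂_ε Z*)*` underlying an element of `I(Y,Z)`. -/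
def IntegralSpace.toFunctional (Φ : IntegralSpace Y Z) : StrongDual 𝕂 (EpsTensor Y (StrongDual 𝕂 Z)) :=
  (show ↥(IntegralSub Y Z) from Φ).1

end IntegralSpace

theorem weakNorm_one_le {E : Type} [NormedAddCommGroup E] [NormedSpace ℝ E] {n : ℕ}
    (e : Fin n → E) (M : ℝ)
    (h : ∀ f : StrongDual ℝ E, ‖f‖ ≤ 1 → ∑ i, |f (e i)| ≤ M) : weakNorm 1 e ≤ M := by
  unfold weakNorm
  haveI : Nonempty {f : StrongDual ℝ E // ‖f‖ ≤ 1} := ⟨⟨0, by simp⟩⟩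
  apply ciSup_le
  rintro ⟨f, hf⟩
  simpa using h f hf

theorem le_weakNorm_one {E : Type} [NormedAddCommGroup E] [NormedSpace ℝ E] {n : ℕ}
    (e : Fin n → E) (f : StrongDual ℝ E) (hf : ‖f‖ ≤ 1) :
    ∑ i, |f (e i)| ≤ weakNorm 1 e := by
  unfold weakNorm
  have hb : BddAbove (Set.range fun f : {f : StrongDual ℝ E // ‖f‖ ≤ 1} =>
      (∑ i, ‖(f : StrongDual ℝ E) (e i)‖ ^ (1 : ℝ)) ^ (1 / (1 : ℝ))) := by
    refine ⟨∑ i, ‖e i‖, ?_⟩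
    rintro _ ⟨⟨g, hg⟩, rfl⟩
    simp only [Real.rpow_one, div_one]
    refine Finset.sum_le_sum fun i _ => ?_
    calc ‖g (e i)‖ ≤ ‖g‖ * ‖e i‖ := g.le_opNorm _
      _ ≤ 1 * ‖e i‖ := by gcongr
      _ = ‖e i‖ := one_mul _
  have := le_ciSup hb ⟨f, hf⟩
  simpa using this

/-- The unit ball of the dual, as a discrete space. -/
def DBall (F : Type) [NormedAddCommGroup F] [NormedSpace ℝ F] : Type :=
  {f : StrongDual ℝ F // ‖f‖ ≤ 1}

section aux
variable {E F : Type} [NormedAddCommGroup E] [NormedSpace ℝ E]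
  [NormedAddCommGroup F] [NormedSpace ℝ F]

instance : TopologicalSpace (DBall F) := ⊥
instance : DiscreteTopology (DBall F) := ⟨rfl⟩
instance : Nonempty (DBall F) := ⟨⟨0, by simp⟩⟩

open BoundedContinuousFunction

theorem DBall.abs_le (s : DBall F) (x : F) : |s.1 x| ≤ ‖x‖ := by
  calc |s.1 x| = ‖s.1 x‖ := rfl
    _ ≤ ‖s.1‖ * ‖x‖ := s.1.le_opNorm _
    _ ≤ 1 * ‖x‖ := by gcongr; exact s.2
    _ = ‖x‖ := one_mul _

/-- The canonical embedding into bounded functions on the dual ball. -/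
def embBall (F : Type) [NormedAddCommGroup F] [NormedSpace ℝ F] :
    F →ₗᵢ[ℝ] (DBall F →ᵇ ℝ) where
  toFun x := BoundedContinuousFunction.ofNormedAddCommGroupDiscrete
    (fun s : DBall F => s.1 x) ‖x‖ (fun s => s.abs_le x)
  map_add' x y := by ext s; simp
  map_smul' c x := by ext s; simp
  norm_map' x := by
    apply le_antisymm
    · exact (BoundedContinuousFunction.norm_le (norm_nonneg _)).2 fun s => s.abs_le x
    · obtain ⟨g, hg, hgx⟩ := exists_dual_vector'' ℝ x
      have := BoundedContinuousFunction.norm_coe_le_norm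
        (BoundedContinuousFunction.ofNormedAddCommGroupDiscrete
          (fun s : DBall F => s.1 x) ‖x‖ (fun s => s.abs_le x)) ⟨g, hg⟩
      simpa [hgx] using this

theorem embBall_apply (x : F) (s : DBall F) : embBall F x s = s.1 x := rfl

/-- Pull back a vector along a finite partition. -/
def pullFin {S : Type} [TopologicalSpace S] [DiscreteTopology S] {n : ℕ} (κ : S → Fin n) :
    (Fin n → ℝ) →ₗ[ℝ] (S →ᵇ ℝ) where
  toFun a := BoundedContinuousFunction.ofNormedAddCommGroupDiscrete
    (fun s => a (κ s)) ‖a‖ (fun s => norm_le_pi_norm a _)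
  map_add' x y := by ext s; simp
  map_smul' c x := by ext s; simp

theorem pullFin_apply {S : Type} [TopologicalSpace S] [DiscreteTopology S] {n : ℕ}
    (κ : S → Fin n) (a : Fin n → ℝ) (s : S) : pullFin κ a s = a (κ s) := rfl

theorem exists_part {S ι : Type} [Nonempty S] [Fintype ι] (g : S → ι → ℝ)
    (hg : Bornology.IsBounded (Set.range g)) (ε : ℝ) (hε : 0 < ε) :
    ∃ (n : ℕ) (κ : S → Fin n) (r : Fin n → S), ∀ s, dist (g s) (g (r (κ s))) ≤ ε := by
  have htb : TotallyBounded (Set.range g) := 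
    (Bornology.IsBounded.isCompact_closure hg).totallyBounded.subset subset_closure
  obtain ⟨t, hts, htf, ht⟩ := (totallyBounded_iff_subset.1 htb) _ (Metric.dist_mem_uniformity hε)
  haveI := htf.fintype
  choose r hr using fun j : t => hts j.2
  have h2 : ∀ s, ∃ j : t, dist (g s) j ≤ ε := by
    intro s
    have := ht ⟨s, rfl⟩
    simp only [Set.mem_iUnion, Set.mem_setOf_eq] at this
    obtain ⟨y, hy, hd⟩ := this
    exact ⟨⟨y, hy⟩, le_of_lt hd⟩
  choose κ hκ using h2
  refine ⟨Fintype.card t, fun s => Fintype.equivFin t (κ s),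
    fun j => r ((Fintype.equivFin t).symm j), fun s => ?_⟩
  simpa [hr] using hκ s

theorem key_bound (T : E →L[ℝ] F) (C : ℝ) (hC : 0 ≤ C) (hT : SummingWithC 1 1 C T)
    {ι : Type} [Fintype ι] (e : ι → E) (f : ι → StrongDual ℝ (DBall F →ᵇ ℝ)) :
    |∑ i, f i (embBall F (T (e i)))| ≤ C * ‖∑ i, elemTensor (e i) (f i)‖ := by
  set u := ∑ i, elemTensor (e i) (f i) with hu
  have hux : ∀ x : StrongDual ℝ E, u x = ∑ i, x (e i) • f i := by
    intro x
    simp [hu, elemTensor, ContinuousLinearMap.sum_apply]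
  have main : ∀ ε > 0, |∑ i, f i (embBall F (T (e i)))| ≤ C * ‖u‖ + (∑ i, ‖f i‖) * ε := by
    intro ε hε
    obtain ⟨n, κ, r, hr⟩ := exists_part (fun (s : DBall F) (i : ι) => s.1 (T (e i))) (by
      rw [isBounded_iff_forall_norm_le]
      refine ⟨∑ i, ‖T (e i)‖, ?_⟩
      rintro _ ⟨s, rfl⟩
      refine (pi_norm_le_iff_of_nonneg (by positivity)).2 fun i => ?_
      exact (s.abs_le _).trans
        (Finset.single_le_sum (f := fun i => ‖T (e i)‖) (fun _ _ => norm_nonneg _)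
          (Finset.mem_univ i))) ε hε
    set x : Fin n → E := fun j => ∑ i, f i (pullFin κ (Pi.single j 1)) • e i with hx
    have hpull : ∀ i (a : Fin n → ℝ),
        f i (pullFin κ a) = ∑ j, a j * f i (pullFin κ (Pi.single j 1)) := by
      intro i a
      conv_lhs => rw [pi_eq_sum_univ' a]
      simp only [map_sum, map_smul, smul_eq_mul]
    have hweak : weakNorm 1 x ≤ ‖u‖ := by
      apply weakNorm_one_le
      intro y hy
      set σ : Fin n → ℝ := fun j => (SignType.sign (y (x j)) : ℝ) with hσ
      have h1 : ∑ j, |y (x j)| = u y (pullFin κ σ) := by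
        rw [hux]
        simp only [ContinuousLinearMap.sum_apply, ContinuousLinearMap.smul_apply, smul_eq_mul]
        simp_rw [hpull _ σ, Finset.mul_sum]
        rw [Finset.sum_comm]
        refine Finset.sum_congr rfl fun j _ => ?_
        rw [← self_mul_sign]
        change y (x j) * σ j = _
        simp only [hx, map_sum, map_smul, smul_eq_mul, Finset.sum_mul]
        refine Finset.sum_congr rfl fun i _ => ?_
        ring
      have h2 : ‖pullFin κ σ‖ ≤ 1 := by
        refine (BoundedContinuousFunction.norm_le zero_le_one).2 fun s => ?_
        rw [pullFin_apply]
        simp only [hσ]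
        rcases SignType.sign (y (x (κ s))) with _ | _ | _ <;> simp
      rw [h1]
      calc u y (pullFin κ σ) ≤ ‖u y (pullFin κ σ)‖ := le_abs_self _
        _ ≤ ‖u y‖ * ‖pullFin κ σ‖ := (u y).le_opNorm _
        _ ≤ (‖u‖ * ‖y‖) * ‖pullFin κ σ‖ := by gcongr; exact u.le_opNorm _
        _ ≤ (‖u‖ * 1) * 1 := by gcongr
        _ = ‖u‖ := by ring
    have hsum : ∑ j, ‖T (x j)‖ ≤ C * ‖u‖ := by
      have := hT n x
      simp only [Real.rpow_one, div_one] at this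
      exact this.trans (by gcongr)
    have hA : ∑ i, f i (pullFin κ fun j => (r j).1 (T (e i))) = ∑ j, (r j).1 (T (x j)) := by
      simp_rw [hpull _ (fun j => (r j).1 (T (e _)))]
      rw [Finset.sum_comm]
      refine Finset.sum_congr rfl fun j _ => ?_
      simp only [hx, map_sum, map_smul, smul_eq_mul]
      refine Finset.sum_congr rfl fun i _ => ?_
      ring
    have hA' : |∑ i, f i (pullFin κ fun j => (r j).1 (T (e i)))| ≤ C * ‖u‖ := by
      rw [hA]
      refine (Finset.abs_sum_le_sum_abs _ _).trans (le_trans ?_ hsum)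
      exact Finset.sum_le_sum fun j _ => (r j).abs_le _
    have hB : |∑ i, f i (embBall F (T (e i)))
        - ∑ i, f i (pullFin κ fun j => (r j).1 (T (e i)))| ≤ (∑ i, ‖f i‖) * ε := by
      rw [← Finset.sum_sub_distrib, Finset.sum_mul]
      refine (Finset.abs_sum_le_sum_abs _ _).trans (Finset.sum_le_sum fun i _ => ?_)
      rw [← map_sub]
      refine ((f i).le_opNorm _).trans ?_
      gcongr
      refine (BoundedContinuousFunction.norm_le hε.le).2 fun s => ?_
      exact (dist_le_pi_dist _ _ i).trans (hr s)
    have := abs_sub_abs_le_abs_sub (∑ i, f i (embBall F (T (e i))))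
      (∑ i, f i (pullFin κ fun j => (r j).1 (T (e i))))
    linarith
  refine le_of_forall_pos_le_add fun δ hδ => ?_
  have hK : 0 ≤ ∑ i, ‖f i‖ := by positivity
  refine (main (δ / (∑ i, ‖f i‖ + 1)) (by positivity)).trans ?_
  gcongr
  rw [mul_div_assoc', div_le_iff₀ (by positivity)]
  nlinarith

theorem integral_of_bound {G : Type} [NormedAddCommGroup G] [NormedSpace ℝ G]
    (T : E →L[ℝ] G) (C : ℝ)
    (h : ∀ (n : Finset (E × StrongDual ℝ G)) (e : n → E) (f : n → StrongDual ℝ G),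
      |∑ i, f i (T (e i))| ≤ C * ‖∑ i, elemTensor (e i) (f i)‖) : IsIntegralOp T := by
  classical
  set q := Finsupp.linearCombination ℝ
    (fun p : E × StrongDual ℝ G => elemTensor p.1 p.2) with hq
  set L := Finsupp.linearCombination ℝ (fun p : E × StrongDual ℝ G => p.2 (T p.1)) with hL
  have hb : ∀ c, ‖L c‖ ≤ C * ‖q c‖ := by
    intro c
    have := h c.support (fun p => c p.1 • p.1.1) (fun p => p.1.2)
    have e1 : L c = ∑ p : c.support, p.1.2 (T (c p.1 • p.1.1)) := by
      rw [hL, Finsupp.linearCombination_apply, Finsupp.sum,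
        ← Finset.sum_coe_sort c.support]
      simp
    have e2 : q c = ∑ p : c.support, elemTensor (c p.1 • p.1.1) p.1.2 := by
      rw [hq, Finsupp.linearCombination_apply, Finsupp.sum,
        ← Finset.sum_coe_sort c.support]
      refine Finset.sum_congr rfl fun p _ => ?_
      ext x
      simp [elemTensor, mul_assoc]
    rw [e1, e2]
    exact this
  obtain ⟨g, hg⟩ := q.rangeRestrict.exists_rightInverse_of_surjective q.range_rangeRestrict
  have hqg : ∀ v, q (g v) = v := fun v =>
    congrArg Subtype.val (LinearMap.congr_fun hg v)
  let ℓ : StrongDual ℝ (LinearMap.range q) := (L ∘ₗ g).mkContinuous C (fun v => by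
    have := hb (g v)
    rw [hqg] at this
    exact this)
  obtain ⟨Φ, hΦ, -⟩ := exists_extension_norm_eq (LinearMap.range q) ℓ
  refine ⟨Φ.comp (epsSub E (StrongDual ℝ G)).subtypeL, fun e f => ?_⟩
  have hqs : q (Finsupp.single (e, f) 1) = elemTensor e f := by simp [hq]
  have h1 := hΦ ⟨elemTensor e f, ⟨_, hqs⟩⟩
  change Φ (elemTensor e f) = _
  refine h1.trans ?_
  change L (g _) = _
  have h2 := hb (g ⟨elemTensor e f, ⟨_, hqs⟩⟩ - Finsupp.single (e, f) 1)
  rw [map_sub q, hqg, hqs] at h2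
  simp only [sub_self, norm_zero, mul_zero, norm_le_zero_iff, map_sub, sub_eq_zero] at h2
  rw [h2]
  simp [hL]

theorem summing_of_integral {G : Type} [NormedAddCommGroup G] [NormedSpace ℝ G]
    (T : E →L[ℝ] F) (φ : F →ₗᵢ[ℝ] G)
    (h : IsIntegralOp (φ.toContinuousLinearMap.comp T)) : IsPSumming 1 T := by
  obtain ⟨Φ, hΦ⟩ := h
  refine ⟨‖Φ‖, norm_nonneg _, fun n e => ?_⟩
  simp only [Real.rpow_one, div_one]
  choose f hf hfe using fun i => exists_dual_vector'' ℝ (φ (T (e i)))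
  have h0 : 0 ≤ weakNorm 1 e := by
    simpa using le_weakNorm_one e 0 (by simp)
  have h1 : ∑ i, ‖T (e i)‖ = Φ (∑ i, tmulEps (e i) (f i)) := by
    rw [map_sum]
    refine Finset.sum_congr rfl fun i _ => ?_
    rw [hΦ]
    have := hfe i
    rw [φ.norm_map] at this
    exact this.symm
  have h2 : ‖∑ i, tmulEps (e i) (f i)‖ ≤ weakNorm 1 e := by
    have h3 : ‖∑ i, tmulEps (e i) (f i)‖ = ‖∑ i, elemTensor (e i) (f i)‖ := by
      have : (epsSub E (StrongDual ℝ G)).subtype (∑ i, tmulEps (e i) (f i))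
          = ∑ i, elemTensor (e i) (f i) := by
        refine (map_sum (epsSub E (StrongDual ℝ G)).subtype _ _).trans ?_
        rfl
      rw [← this]
      rfl
    rw [h3]
    refine ContinuousLinearMap.opNorm_le_of_unit_norm h0 fun x hx => ?_
    have : (∑ i, elemTensor (e i) (f i)) x = ∑ i, x (e i) • f i := by
      simp [elemTensor, ContinuousLinearMap.sum_apply]
    rw [this]
    refine (norm_sum_le _ _).trans (le_trans ?_ (le_weakNorm_one e x hx.le))
    refine Finset.sum_le_sum fun i _ => ?_
    rw [norm_smul, Real.norm_eq_abs]
    exact mul_le_of_le_one_right (abs_nonneg _) (hf i)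
  rw [h1]
  calc Φ _ ≤ ‖Φ (∑ i, tmulEps (e i) (f i))‖ := le_abs_self _
    _ ≤ ‖Φ‖ * ‖∑ i, tmulEps (e i) (f i)‖ := Φ.le_opNorm _
    _ ≤ _ := by gcongr

end aux

/-- Proposition 1: a bounded linear operator `T : E → F` between Banach spaces is
1-summing if and only if there exist a Banach space `F₁` and a linear isometric embedding
`φ : F → F₁` such that `φ ∘ T : E → F₁` is an integral operator. -/
theorem statement0 (E F : Type) [NormedAddCommGroup E] [NormedSpace ℝ E] [CompleteSpace E]
    [NormedAddCommGroup F] [NormedSpace ℝ F] [CompleteSpace F] (T : E →L[ℝ] F) :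
    IsPSumming 1 T ↔
      ∃ (F₁ : Type) (_ : NormedAddCommGroup F₁) (_ : NormedSpace ℝ F₁) (_ : CompleteSpace F₁)
        (φ : F →ₗᵢ[ℝ] F₁),
        IsIntegralOp (φ.toContinuousLinearMap.comp T) := by
  constructor
  · rintro ⟨C, hC, hT⟩
    refine ⟨BoundedContinuousFunction (DBall F) ℝ, inferInstance, inferInstance, inferInstance,
      embBall F, ?_⟩
    exact integral_of_bound _ C fun n e f => key_bound T C hC hT e f
  · rintro ⟨G, i1, i2, i3, φ, h⟩
    exact summing_of_integral T φ h
end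
end

section
/- Let X, Y and Z be Banach spaces, let T : X ⊗̂_ε Y → Z be a bounded linear operator, let i : Z → Z** be the canonical isometric embedding, and let î : I(Y,Z) → I(Y,Z**) be given by î(U) = i∘U. Then T is an integral operator if and only if î∘T# : X → I(Y,Z**) is an integral operator; moreover, in that case ‖î∘T#‖_int = ‖T‖_int. -/
set_option maxHeartbeats 1000000
set_option synthInstance.maxHeartbeats 400000
set_option maxSynthPendingDepth 3

noncomputable section

open scoped BigOperators NNReal ENNReal
open NormedSpace

section Helpers

open scoped TensorProduct

/-- Hahn–Banach: a linear form dominated through a linear map factors through it. -/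
lemma exists_factor_sub {D E : Type} [AddCommGroup D] [Module ℝ D]
    [AddCommGroup E] [Module ℝ E] (p : D →ₗ[ℝ] E) (b : D →ₗ[ℝ] ℝ)
    (N : E → ℝ) (hN0 : N 0 = 0) (hN1 : ∀ c : ℝ, 0 < c → ∀ x, N (c • x) = c * N x)
    (hN2 : ∀ x y, N (x + y) ≤ N x + N y) (h : ∀ d, b d ≤ N (p d)) :
    ∃ F : E →ₗ[ℝ] ℝ, (∀ d, F (p d) = b d) ∧ ∀ e, F e ≤ N e := by
  have hker : b ∈ (LinearMap.ker p).dualAnnihilator := by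
    rw [Submodule.mem_dualAnnihilator]
    intro d hd
    have hd' : p d = 0 := hd
    have h1 := h d
    have h2 := h (-d)
    simp only [map_neg, hd', neg_zero, hN0] at h1 h2
    linarith
  rw [← LinearMap.range_dualMap_eq_dualAnnihilator_ker] at hker
  obtain ⟨g, hg⟩ := hker
  have hg' : ∀ d, g (p d) = b d := fun d => by rw [← hg]; rfl
  obtain ⟨F, hF1, hF2⟩ := exists_extension_of_le_sublinear
    (⟨LinearMap.range p, g.domRestrict _⟩ : E →ₗ.[ℝ] ℝ) N hN1 hN2
    (by
      rintro ⟨_, d, rfl⟩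
      change g (p d) ≤ _
      rw [hg']
      exact h d)
  refine ⟨F, fun d => ?_, hF2⟩
  have := hF1 ⟨p d, d, rfl⟩
  rw [← hg' d]
  exact this

/-- Hahn–Banach: a linear form dominated by the norm of a linear map factors through it. -/
lemma exists_factor {D E : Type} [AddCommGroup D] [Module ℝ D]
    [NormedAddCommGroup E] [NormedSpace ℝ E] (p : D →ₗ[ℝ] E) (b : D →ₗ[ℝ] ℝ)
    (C : ℝ) (hC : 0 ≤ C) (h : ∀ d, b d ≤ C * ‖p d‖) :
    ∃ F : StrongDual ℝ E, (∀ d, F (p d) = b d) ∧ ‖F‖ ≤ C := by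
  obtain ⟨F, hF1, hF2⟩ := exists_factor_sub p b (fun e => C * ‖e‖) (by simp)
    (by
      intro c hc x
      simp only [norm_smul, Real.norm_eq_abs, abs_of_pos hc]
      ring)
    (by
      intro x y
      have := norm_add_le x y
      calc C * ‖x + y‖ ≤ C * (‖x‖ + ‖y‖) := by gcongr
        _ = _ := by ring) h
  have hFb : ∀ e, ‖F e‖ ≤ C * ‖e‖ := by
    intro e
    rw [Real.norm_eq_abs, abs_le]
    have h1 := hF2 e
    have h2 := hF2 (-e)
    simp only [map_neg, norm_neg] at h2
    constructor <;> linarith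
  exact ⟨F.mkContinuous C hFb, fun d => hF1 d, LinearMap.mkContinuous_norm_le _ hC _⟩

section

variable {A B : Type} [NormedAddCommGroup A] [NormedSpace ℝ A]
  [NormedAddCommGroup B] [NormedSpace ℝ B]

/-- The underlying operator of a tensor. -/
def toOp (A B : Type) [NormedAddCommGroup A] [NormedSpace ℝ A]
    [NormedAddCommGroup B] [NormedSpace ℝ B] :
    EpsTensor A B →L[ℝ] (StrongDual ℝ A →L[ℝ] B) :=
  (epsSub A B).subtypeL

lemma norm_toOp (u : EpsTensor A B) : ‖toOp A B u‖ = ‖u‖ := rfl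

lemma toOp_injective : Function.Injective (toOp A B) := Subtype.val_injective

@[simp] lemma toOp_tmul (a : A) (b : B) (g : StrongDual ℝ A) :
    toOp A B (tmulEps a b) g = g a • b := rfl

lemma tmulLeft_apply (a : A) (b : B) : tmulLeft a b = tmulEps a b := rfl

lemma norm_tmul_le (a : A) (b : B) : ‖tmulEps a b‖ ≤ ‖a‖ * ‖b‖ := by
  rw [← norm_toOp]
  refine ContinuousLinearMap.opNorm_le_bound _ (by positivity) fun g => ?_
  rw [toOp_tmul, norm_smul]
  have := g.le_opNorm a
  calc ‖g a‖ * ‖b‖ ≤ (‖g‖ * ‖a‖) * ‖b‖ := by gcongr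
    _ = _ := by ring

/-- `tmulEps` as a bilinear map. -/
def tmulBil (A B : Type) [NormedAddCommGroup A] [NormedSpace ℝ A]
    [NormedAddCommGroup B] [NormedSpace ℝ B] : A →ₗ[ℝ] B →ₗ[ℝ] EpsTensor A B :=
  LinearMap.mk₂ ℝ tmulEps
    (fun a a' b => toOp_injective (by ext g; simp [add_smul]))
    (fun c a b => toOp_injective (by ext g; simp [mul_smul]))
    (fun a b b' => toOp_injective (by ext g; simp [smul_add]))
    (fun c a b => toOp_injective (by ext g; simp [smul_comm c]))

@[simp] lemma tmulBil_apply (a : A) (b : B) : tmulBil A B a b = tmulEps a b := rfl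

/-- The map of the algebraic tensor product to the injective one. -/
def algMap (A B : Type) [NormedAddCommGroup A] [NormedSpace ℝ A]
    [NormedAddCommGroup B] [NormedSpace ℝ B] : A ⊗[ℝ] B →ₗ[ℝ] EpsTensor A B :=
  TensorProduct.lift (tmulBil A B)

@[simp] lemma algMap_tmul (a : A) (b : B) : algMap A B (a ⊗ₜ b) = tmulEps a b := rfl

/-- Continuous linear maps agreeing on elementary tensors are equal. -/
lemma eps_ext {G : Type} [NormedAddCommGroup G] [NormedSpace ℝ G]
    (F F' : EpsTensor A B →L[ℝ] G) (h : ∀ a b, F (tmulEps a b) = F' (tmulEps a b)) : F = F' := by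
  ext u
  have key : ∀ (v : StrongDual ℝ A →L[ℝ] B)
      (hv : v ∈ Submodule.span ℝ (Set.range fun p : A × B => elemTensor p.1 p.2)),
      ∀ hv' : v ∈ epsSub A B, F (⟨v, hv'⟩ : epsSub A B) = F' (⟨v, hv'⟩ : epsSub A B) := by
    intro v hv
    have : ∃ d, toOp A B (algMap A B d) = v := by
      induction hv using Submodule.span_induction with
      | mem x hx =>
        obtain ⟨p, rfl⟩ := hx
        exact ⟨p.1 ⊗ₜ p.2, rfl⟩
      | zero => exact ⟨0, by simp⟩
      | add x y _ _ hx hy =>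
        obtain ⟨d, rfl⟩ := hx
        obtain ⟨d', rfl⟩ := hy
        exact ⟨d + d', by simp⟩
      | smul c x _ hx =>
        obtain ⟨d, rfl⟩ := hx
        exact ⟨c • d, by simp⟩
    obtain ⟨d, rfl⟩ := this
    intro hv'
    change F (algMap A B d) = F' (algMap A B d)
    have : F.toLinearMap ∘ₗ algMap A B = F'.toLinearMap ∘ₗ algMap A B :=
      TensorProduct.ext' fun a b => h a b
    exact LinearMap.congr_fun this d
  obtain ⟨v, hv⟩ := u
  have hv2 : v ∈ closure ((Submodule.span ℝ
      (Set.range fun p : A × B => elemTensor p.1 p.2) : Submodule ℝ _) : Set _) := hv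
  obtain ⟨s, hs, hlim⟩ := mem_closure_iff_seq_limit.1 hv2
  have hs' : ∀ n, s n ∈ epsSub A B := fun n => Submodule.le_topologicalClosure _ (hs n)
  have hlim' : Filter.Tendsto (fun n => ((⟨s n, hs' n⟩ : epsSub A B) : EpsTensor A B)) Filter.atTop
      (nhds ((⟨v, hv⟩ : epsSub A B) : EpsTensor A B)) := by
    exact tendsto_subtype_rng.2 hlim
  have h1 := (F.continuous.tendsto _).comp hlim'
  have h2 := (F'.continuous.tendsto _).comp hlim'
  refine tendsto_nhds_unique h1 (h2.congr fun n => ?_)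
  exact (key _ (hs n) (hs' n)).symm

/-- dual pairing bound on a tensor -/
lemma toOp_le (u : EpsTensor A B) (g : StrongDual ℝ A) : ‖toOp A B u g‖ ≤ ‖u‖ * ‖g‖ :=
  (toOp A B u).le_opNorm g

lemma eps_norm_le (u : EpsTensor A B) (C : ℝ) (hC : 0 ≤ C)
    (h : ∀ g : StrongDual ℝ A, ‖toOp A B u g‖ ≤ C * ‖g‖) : ‖u‖ ≤ C :=
  ContinuousLinearMap.opNorm_le_bound (toOp A B u) hC h

end

/-- The net lemma. -/
lemma exists_net {X : Type} [NormedAddCommGroup X] [NormedSpace ℝ X] {ι : Type} [Fintype ι]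
    (x : ι → X) (ε : ℝ) (hε : 0 < ε) :
    ∃ (κ : Type) (_ : Fintype κ) (t : κ → StrongDual ℝ X), (∀ k, ‖t k‖ ≤ 1) ∧
      ∀ g : StrongDual ℝ X, ‖g‖ ≤ 1 → ∃ k, ∀ i, |g (x i) - t k (x i)| ≤ ε := by
  classical
  let e : StrongDual ℝ X → (ι → ℝ) := fun g i => g (x i)
  have hb : Bornology.IsBounded (e '' {g | ‖g‖ ≤ 1}) := by
    rw [isBounded_iff_forall_norm_le]
    refine ⟨∑ i, ‖x i‖, ?_⟩
    rintro _ ⟨g, hg, rfl⟩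
    have hg' : ‖g‖ ≤ 1 := hg
    rw [pi_norm_le_iff_of_nonneg (by positivity)]
    intro i
    calc ‖g (x i)‖ ≤ ‖g‖ * ‖x i‖ := g.le_opNorm _
      _ ≤ 1 * ‖x i‖ := by gcongr
      _ = ‖x i‖ := one_mul _
      _ ≤ _ := Finset.single_le_sum (f := fun i => ‖x i‖) (fun _ _ => norm_nonneg _)
          (Finset.mem_univ i)
  have htb : TotallyBounded (e '' {g | ‖g‖ ≤ 1}) :=
    hb.isCompact_closure.totallyBounded.subset subset_closure
  obtain ⟨s, hs1, hs2, hs3⟩ := Metric.finite_approx_of_totallyBounded htb ε hε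
  have hs1' : ∀ v : s, ∃ g : StrongDual ℝ X, ‖g‖ ≤ 1 ∧ e g = v := fun v => hs1 v.2
  choose c hc1 hc2 using hs1'
  have := hs2.fintype
  -- the index type is the finite net in coordinates
  refine ⟨s, this, c, hc1, fun g hg => ?_⟩
  obtain ⟨v, hv, hgv⟩ := Set.mem_iUnion₂.1 (hs3 ⟨g, hg, rfl⟩)
  refine ⟨⟨v, hv⟩, fun i => ?_⟩
  have h1 : dist (e g i) (v i) ≤ dist (e g) v := dist_le_pi_dist _ _ i
  have h2 : dist (e g) v < ε := hgv
  have h3 : c ⟨v, hv⟩ (x i) = v i := congr_fun (hc2 ⟨v, hv⟩) i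
  rw [Real.dist_eq] at h1
  change |e g i - c ⟨v, hv⟩ (x i)| ≤ ε
  rw [h3]
  linarith

/-- The norm in the dual of a finite sup-sum is the sum of the norms. -/
lemma sum_norm_le {W κ : Type} [NormedAddCommGroup W] [NormedSpace ℝ W] [Fintype κ]
    (h : κ → StrongDual ℝ W) (C : ℝ)
    (hC : ∀ a : κ → W, (∀ k, ‖a k‖ ≤ 1) → ∑ k, h k (a k) ≤ C) : ∑ k, ‖h k‖ ≤ C := by
  have key : ∀ δ : ℝ, 0 < δ → ∀ k, ∃ a : W, ‖a‖ ≤ 1 ∧ ‖h k‖ - δ ≤ h k a := by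
    intro δ hδ k
    obtain ⟨a, ha, hr⟩ := ContinuousLinearMap.exists_lt_apply_of_lt_opNorm (h k)
      (sub_lt_self ‖h k‖ hδ)
    rcases le_total 0 (h k a) with h0 | h0
    · refine ⟨a, ha.le, ?_⟩
      rw [Real.norm_of_nonneg h0] at hr
      exact hr.le
    · refine ⟨-a, by simpa using ha.le, ?_⟩
      rw [Real.norm_of_nonpos h0] at hr
      simpa using hr.le
  have key2 : ∀ δ : ℝ, 0 < δ → ∑ k, ‖h k‖ ≤ C + δ * Fintype.card κ := by
    intro δ hδ
    choose a ha1 ha2 using key δ hδ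
    have h1 := hC a ha1
    have h2 : ∑ k, (‖h k‖ - δ) ≤ ∑ k, h k (a k) := Finset.sum_le_sum fun k _ => ha2 k
    rw [Finset.sum_sub_distrib] at h2
    simp only [Finset.sum_const, Finset.card_univ, nsmul_eq_mul] at h2
    linarith
  refine le_of_forall_pos_le_add fun δ hδ => ?_
  have hp : (0 : ℝ) < Fintype.card κ + 1 := by positivity
  have := key2 (δ / (Fintype.card κ + 1)) (by positivity)
  refine this.trans ?_
  gcongr
  rw [div_mul_eq_mul_div, div_le_iff₀ hp]
  nlinarith

/-- The canonical extension of `φ ∈ (X ⊗ W)*` to `X ⊗ W**` is bounded by `‖φ‖`. -/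
lemma bidual_bound {X W ι : Type} [NormedAddCommGroup X] [NormedSpace ℝ X]
    [NormedAddCommGroup W] [NormedSpace ℝ W] [Fintype ι]
    (φ : StrongDual ℝ (EpsTensor X W)) (x : ι → X)
    (f : ι → StrongDual ℝ (StrongDual ℝ W)) :
    ∑ i, f i (φ.comp (tmulLeft (x i))) ≤ ‖φ‖ * ‖∑ i, tmulEps (x i) (f i)‖ := by
  classical
  have main : ∀ ε : ℝ, 0 < ε → ∑ i, f i (φ.comp (tmulLeft (x i))) ≤
      ‖φ‖ * ‖∑ i, tmulEps (x i) (f i)‖ + ε * (‖φ‖ * ∑ i, ‖f i‖) := by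
    intro ε hε
    obtain ⟨κ, _, t, ht1, ht2⟩ := exists_net x ε hε
    let p : (ι → W) →ₗ[ℝ] (κ → W) × (ι → W) :=
      LinearMap.prod (LinearMap.pi fun k => ∑ i, (t k (x i)) • LinearMap.proj i) LinearMap.id
    have hp1 : ∀ w k, (p w).1 k = ∑ i, t k (x i) • w i := by
      intro w k
      simp [p]
    have hp2 : ∀ w, (p w).2 = w := fun w => rfl
    let b : (ι → W) →ₗ[ℝ] ℝ :=
      ∑ i, (φ.comp (tmulLeft (x i))).toLinearMap ∘ₗ LinearMap.proj i
    have hb : ∀ w, b w = φ (∑ i, tmulEps (x i) (w i)) := by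
      intro w
      simp [b, tmulLeft_apply]
    let N : (κ → W) × (ι → W) → ℝ := fun q => ‖φ‖ * (‖q.1‖ + ε * ∑ i, ‖q.2 i‖)
    obtain ⟨F, hF1, hF2⟩ := exists_factor_sub p b N (by simp [N])
      (by
        intro c hc q
        simp only [N, Prod.smul_fst, Prod.smul_snd, Pi.smul_apply, norm_smul, Real.norm_eq_abs,
          abs_of_pos hc, ← Finset.mul_sum]
        ring)
      (by
        intro q r
        have h1 : ‖q.1 + r.1‖ ≤ ‖q.1‖ + ‖r.1‖ := norm_add_le _ _
        have h2 : ∑ i, ‖q.2 i + r.2 i‖ ≤ ∑ i, ‖q.2 i‖ + ∑ i, ‖r.2 i‖ := by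
          rw [← Finset.sum_add_distrib]
          exact Finset.sum_le_sum fun i _ => norm_add_le _ _
        calc N (q + r) ≤ ‖φ‖ * ((‖q.1‖ + ‖r.1‖) + ε * (∑ i, ‖q.2 i‖ + ∑ i, ‖r.2 i‖)) := by
              simp only [N, Prod.fst_add, Prod.snd_add, Pi.add_apply]
              gcongr
          _ = N q + N r := by simp only [N]; ring)
      (by
        intro w
        rw [hb]
        refine (le_abs_self _).trans ((φ.le_opNorm _).trans ?_)
        simp only [N]
        gcongr
        rw [← norm_toOp]
        refine ContinuousLinearMap.opNorm_le_of_unit_norm (by positivity) fun g hg => ?_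
        obtain ⟨k, hk⟩ := ht2 g hg.le
        have e1 : toOp X W (∑ i, tmulEps (x i) (w i)) g
            = (p w).1 k + ∑ i, (g (x i) - t k (x i)) • w i := by
          rw [hp1, ← Finset.sum_add_distrib, map_sum, sum_apply]
          refine Finset.sum_congr rfl fun i _ => ?_
          rw [toOp_tmul, ← add_smul]
          congr 1
          ring
        rw [e1]
        refine (norm_add_le _ _).trans (add_le_add (norm_le_pi_norm _ k) ?_)
        refine (norm_sum_le _ _).trans ?_
        rw [Finset.mul_sum]
        refine Finset.sum_le_sum fun i _ => ?_
        rw [norm_smul, hp2]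
        gcongr
        exact hk i)
    -- components of F
    have hbnd : ∀ q, |F q| ≤ N q := by
      intro q
      have h1 := hF2 q
      have h2 := hF2 (-q)
      have h3 : N (-q) = N q := by simp [N]
      rw [map_neg, h3] at h2
      exact abs_le.2 ⟨by linarith, h1⟩
    let h : κ → StrongDual ℝ W := fun k =>
      (F ∘ₗ LinearMap.inl ℝ (κ → W) (ι → W) ∘ₗ LinearMap.single ℝ (fun _ : κ => W) k).mkContinuous
        ‖φ‖ (by
          intro w
          refine (hbnd _).trans ?_
          have h1 : ‖(Pi.single k w : κ → W)‖ ≤ ‖w‖ := by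
            rw [pi_norm_le_iff_of_nonneg (norm_nonneg _)]
            intro j
            by_cases hj : j = k
            · subst hj; simp
            · simp [hj]
          simp only [N, LinearMap.comp_apply, LinearMap.inl_apply, LinearMap.single_apply,
            Pi.zero_apply, norm_zero, Finset.sum_const_zero, mul_zero, add_zero]
          gcongr)
    let l : ι → StrongDual ℝ W := fun i =>
      (F ∘ₗ LinearMap.inr ℝ (κ → W) (ι → W) ∘ₗ LinearMap.single ℝ (fun _ : ι => W) i).mkContinuous
        (‖φ‖ * ε) (by
          intro w
          refine (hbnd _).trans ?_
          have : ∑ j, ‖(Pi.single i w : ι → W) j‖ = ‖w‖ := by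
            rw [Finset.sum_eq_single i]
            · simp
            · intro j _ hj
              simp [hj]
            · simp
          simp [N, this, mul_assoc])
    have hl : ∀ i, ‖l i‖ ≤ ‖φ‖ * ε := fun i =>
      LinearMap.mkContinuous_norm_le _ (by positivity) _
    have hF1' : ∀ a : κ → W, F (a, 0) = ∑ k, h k (a k) := by
      intro a
      have : a = ∑ k, Pi.single k (a k) := (Finset.univ_sum_single a).symm
      have h2 : (F ∘ₗ LinearMap.inl ℝ (κ → W) (ι → W)) a = ∑ k, h k (a k) := by
        conv_lhs => rw [this]
        rw [map_sum]
        rfl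
      exact h2
    have hhsum : ∑ k, ‖h k‖ ≤ ‖φ‖ := by
      refine sum_norm_le h _ fun a ha => ?_
      rw [← hF1']
      refine (hF2 _).trans ?_
      have : ‖a‖ ≤ 1 := (pi_norm_le_iff_of_nonneg zero_le_one).2 ha
      simp only [N, Pi.zero_apply, norm_zero, Finset.sum_const_zero, mul_zero, add_zero]
      nlinarith [norm_nonneg φ]
    have hrep : ∀ i, φ.comp (tmulLeft (x i)) = ∑ k, t k (x i) • h k + l i := by
      intro i
      ext w
      have h1 := hF1 (Pi.single i w)
      have h2 : p (Pi.single i w) = (fun k => t k (x i) • w, 0) + (0, Pi.single i w) := by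
        refine Prod.ext ?_ ?_
        · funext k
          rw [hp1, Finset.sum_eq_single i]
          · simp
          · intro j _ hj
            simp [hj]
          · simp
        · simp [hp2]
      have h3 : b (Pi.single i w) = φ (tmulEps (x i) w) := by
        simp only [b, LinearMap.sum_apply]
        rw [Finset.sum_eq_single i]
        · simp [tmulLeft_apply]
        · intro j _ hj
          simp [hj]
        · simp
      rw [h2, map_add, hF1', h3] at h1
      have h4 : F (0, Pi.single i w) = l i w := rfl
      rw [h4] at h1
      rw [ContinuousLinearMap.comp_apply, tmulLeft_apply, ← h1]
      simp
    have hs : ∑ i, f i (φ.comp (tmulLeft (x i))) =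
        ∑ k, (toOp _ _ (∑ i, tmulEps (x i) (f i)) (t k)) (h k) + ∑ i, f i (l i) := by
      simp only [hrep, map_add, map_sum, map_smul, Finset.sum_add_distrib,
        sum_apply, toOp_tmul, smul_apply]
      rw [Finset.sum_comm]
    rw [hs]
    refine add_le_add ?_ ?_
    · calc _ ≤ ∑ k, ‖∑ i, tmulEps (x i) (f i)‖ * ‖h k‖ := by
            refine Finset.sum_le_sum fun k _ => ?_
            refine (le_abs_self _).trans ((ContinuousLinearMap.le_opNorm
              (toOp _ _ (∑ i, tmulEps (x i) (f i)) (t k)) (h k)).trans ?_)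
            gcongr
            refine (toOp_le _ _).trans ?_
            exact mul_le_of_le_one_right (norm_nonneg _) (ht1 k)
        _ = ‖∑ i, tmulEps (x i) (f i)‖ * ∑ k, ‖h k‖ := by rw [Finset.mul_sum]
        _ ≤ ‖∑ i, tmulEps (x i) (f i)‖ * ‖φ‖ := by gcongr
        _ = _ := mul_comm _ _
    · rw [← mul_assoc, Finset.mul_sum]
      refine Finset.sum_le_sum fun i _ => ?_
      refine (le_abs_self _).trans (((f i).le_opNorm _).trans ?_)
      rw [mul_comm, mul_comm ε]
      gcongr
      exact hl i
  refine le_of_forall_pos_le_add fun δ hδ => ?_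
  set M := ‖φ‖ * ∑ i, ‖f i‖ with hM
  have hM0 : 0 ≤ M := by positivity
  refine (main (δ / (M + 1)) (by positivity)).trans ?_
  gcongr
  rw [div_mul_eq_mul_div, div_le_iff₀ (by positivity)]
  nlinarith

section Assoc

variable {X Y V : Type} [NormedAddCommGroup X] [NormedSpace ℝ X]
  [NormedAddCommGroup Y] [NormedSpace ℝ Y] [NormedAddCommGroup V] [NormedSpace ℝ V]

/-- `(x ⊗ y) ⊗ v` in `(X ⊗ Y) ⊗ V`. -/
def lmap (X Y V : Type) [NormedAddCommGroup X] [NormedSpace ℝ X]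
    [NormedAddCommGroup Y] [NormedSpace ℝ Y] [NormedAddCommGroup V] [NormedSpace ℝ V] :
    (X ⊗[ℝ] Y) ⊗[ℝ] V →ₗ[ℝ] EpsTensor (EpsTensor X Y) V :=
  algMap (EpsTensor X Y) V ∘ₗ (algMap X Y).rTensor V

/-- `x ⊗ (y ⊗ v)` in `X ⊗ (Y ⊗ V)`. -/
def rmap (X Y V : Type) [NormedAddCommGroup X] [NormedSpace ℝ X]
    [NormedAddCommGroup Y] [NormedSpace ℝ Y] [NormedAddCommGroup V] [NormedSpace ℝ V] :
    (X ⊗[ℝ] Y) ⊗[ℝ] V →ₗ[ℝ] EpsTensor X (EpsTensor Y V) :=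
  algMap X (EpsTensor Y V) ∘ₗ (algMap Y V).lTensor X ∘ₗ
    (TensorProduct.assoc ℝ X Y V).toLinearMap

@[simp] lemma lmap_tmul (x : X) (y : Y) (v : V) :
    lmap X Y V ((x ⊗ₜ y) ⊗ₜ v) = tmulEps (tmulEps x y) v := rfl

@[simp] lemma rmap_tmul (x : X) (y : Y) (v : V) :
    rmap X Y V ((x ⊗ₜ y) ⊗ₜ v) = tmulEps x (tmulEps y v) := rfl

/-- `v ↦ ζ v` in the last variable. -/
def smap (X Y : Type) {V : Type} [NormedAddCommGroup X] [NormedSpace ℝ X]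
    [NormedAddCommGroup Y] [NormedSpace ℝ Y] [NormedAddCommGroup V] [NormedSpace ℝ V]
    (ζ : StrongDual ℝ V) :
    (X ⊗[ℝ] Y) ⊗[ℝ] V →ₗ[ℝ] EpsTensor X Y :=
  algMap X Y ∘ₗ (TensorProduct.rid ℝ (X ⊗[ℝ] Y)).toLinearMap ∘ₗ
    ζ.toLinearMap.lTensor (X ⊗[ℝ] Y)

@[simp] lemma smap_tmul (ζ : StrongDual ℝ V) (x : X) (y : Y) (v : V) :
    smap X Y ζ ((x ⊗ₜ y) ⊗ₜ v) = ζ v • tmulEps x y := by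
  simp [smap]

/-- The functional `g ⊗ h` on `X ⊗ Y`. -/
def prodFun (g : StrongDual ℝ X) (h : StrongDual ℝ Y) : StrongDual ℝ (EpsTensor X Y) :=
  h.comp ((ContinuousLinearMap.apply ℝ Y g).comp (toOp X Y))

lemma prodFun_apply (g : StrongDual ℝ X) (h : StrongDual ℝ Y) (u : EpsTensor X Y) :
    prodFun g h u = h (toOp X Y u g) := rfl

lemma norm_prodFun_le (g : StrongDual ℝ X) (h : StrongDual ℝ Y) :
    ‖prodFun g h‖ ≤ ‖g‖ * ‖h‖ := by
  refine ContinuousLinearMap.opNorm_le_bound _ (by positivity) fun u => ?_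
  rw [prodFun_apply]
  refine (h.le_opNorm _).trans ?_
  calc ‖h‖ * ‖toOp X Y u g‖ ≤ ‖h‖ * (‖u‖ * ‖g‖) := by gcongr; exact toOp_le u g
    _ = _ := by ring

lemma trip_ext {G : Type} [AddCommGroup G] [Module ℝ G]
    (a b : (X ⊗[ℝ] Y) ⊗[ℝ] V →ₗ[ℝ] G)
    (h : ∀ x y v, a ((x ⊗ₜ y) ⊗ₜ v) = b ((x ⊗ₜ y) ⊗ₜ v)) : a = b :=
  TensorProduct.ext_threefold h

lemma ident1 (g : StrongDual ℝ X) (h : StrongDual ℝ Y) (d : (X ⊗[ℝ] Y) ⊗[ℝ] V) :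
    toOp Y V (toOp X _ (rmap X Y V d) g) h = toOp _ V (lmap X Y V d) (prodFun g h) := by
  induction d using TensorProduct.induction_on with
  | zero => simp
  | add a b ha hb => simp only [map_add, add_apply, ha, hb]
  | tmul t v =>
    induction t using TensorProduct.induction_on with
    | zero => simp
    | add a b ha hb => simp only [TensorProduct.add_tmul, map_add, add_apply, ha, hb]
    | tmul x y => simp [prodFun_apply, mul_smul]

lemma ident2 (ζ : StrongDual ℝ V) (ψ : StrongDual ℝ (EpsTensor X Y)) (d : (X ⊗[ℝ] Y) ⊗[ℝ] V) :
    ζ (toOp _ V (lmap X Y V d) ψ) = ψ (smap X Y ζ d) := by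
  induction d using TensorProduct.induction_on with
  | zero => simp
  | add a b ha hb => simp only [map_add, add_apply, ha, hb]
  | tmul t v =>
    induction t using TensorProduct.induction_on with
    | zero => simp
    | add a b ha hb => simp only [TensorProduct.add_tmul, map_add, add_apply, ha, hb]
    | tmul x y => simp [mul_comm]

lemma norm_rmap_le (d : (X ⊗[ℝ] Y) ⊗[ℝ] V) : ‖rmap X Y V d‖ ≤ ‖lmap X Y V d‖ := by
  refine eps_norm_le _ _ (norm_nonneg _) fun g => ?_
  refine eps_norm_le _ _ (by positivity) fun h => ?_
  rw [ident1]
  refine (toOp_le _ _).trans ?_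
  rw [mul_assoc]
  gcongr
  exact norm_prodFun_le g h

lemma norm_lmap_le (d : (X ⊗[ℝ] Y) ⊗[ℝ] V) : ‖lmap X Y V d‖ ≤ ‖rmap X Y V d‖ := by
  refine eps_norm_le _ _ (norm_nonneg _) fun ψ => ?_
  refine NormedSpace.norm_le_dual_bound ℝ _ (by positivity) fun ζ => ?_
  rw [ident2]
  have hs : ‖smap X Y ζ d‖ ≤ ‖rmap X Y V d‖ * ‖ζ‖ := by
    refine eps_norm_le _ _ (by positivity) fun g => ?_
    refine NormedSpace.norm_le_dual_bound ℝ _ (by positivity) fun h => ?_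
    rw [← prodFun_apply, ← ident2, ← ident1]
    calc _ ≤ ‖ζ‖ * ‖toOp Y V (toOp X _ (rmap X Y V d) g) h‖ := ζ.le_opNorm _
      _ ≤ ‖ζ‖ * (‖toOp X _ (rmap X Y V d) g‖ * ‖h‖) := by gcongr; exact toOp_le _ _
      _ ≤ ‖ζ‖ * ((‖rmap X Y V d‖ * ‖g‖) * ‖h‖) := by gcongr; exact toOp_le _ _
      _ = _ := by ring
  calc _ ≤ ‖ψ‖ * ‖smap X Y ζ d‖ := ψ.le_opNorm _
    _ ≤ ‖ψ‖ * (‖rmap X Y V d‖ * ‖ζ‖) := by gcongr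
    _ = _ := by ring

lemma transfer_lr (Φ : StrongDual ℝ (EpsTensor (EpsTensor X Y) V)) :
    ∃ φ : StrongDual ℝ (EpsTensor X (EpsTensor Y V)), ‖φ‖ ≤ ‖Φ‖ ∧
      ∀ x y v, φ (tmulEps x (tmulEps y v)) = Φ (tmulEps (tmulEps x y) v) := by
  obtain ⟨φ, h1, h2⟩ := exists_factor (rmap X Y V) (Φ.toLinearMap ∘ₗ lmap X Y V) ‖Φ‖
    (norm_nonneg _) (fun d => (le_abs_self _).trans ((Φ.le_opNorm _).trans (by
      gcongr; exact norm_lmap_le d)))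
  exact ⟨φ, h2, fun x y v => h1 ((x ⊗ₜ y) ⊗ₜ v)⟩

lemma transfer_rl (φ : StrongDual ℝ (EpsTensor X (EpsTensor Y V))) :
    ∃ Φ : StrongDual ℝ (EpsTensor (EpsTensor X Y) V), ‖Φ‖ ≤ ‖φ‖ ∧
      ∀ x y v, Φ (tmulEps (tmulEps x y) v) = φ (tmulEps x (tmulEps y v)) := by
  obtain ⟨Φ, h1, h2⟩ := exists_factor (lmap X Y V) (φ.toLinearMap ∘ₗ rmap X Y V) ‖φ‖
    (norm_nonneg _) (fun d => (le_abs_self _).trans ((φ.le_opNorm _).trans (by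
      gcongr; exact norm_rmap_le d)))
  exact ⟨Φ, h2, fun x y v => h1 ((x ⊗ₜ y) ⊗ₜ v)⟩

end Assoc

section Bidual

variable {X W : Type} [NormedAddCommGroup X] [NormedSpace ℝ X]
  [NormedAddCommGroup W] [NormedSpace ℝ W]

lemma restrict_bidual (Ψ : StrongDual ℝ (EpsTensor X (StrongDual ℝ (StrongDual ℝ W)))) :
    ∃ φ : StrongDual ℝ (EpsTensor X W), ‖φ‖ ≤ ‖Ψ‖ ∧
      ∀ x w, φ (tmulEps x w) = Ψ (tmulEps x (inclusionInDoubleDual ℝ W w)) := by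
  let J := inclusionInDoubleDual ℝ W
  have id1 : ∀ (d : X ⊗[ℝ] W) (g : StrongDual ℝ X),
      toOp _ _ (algMap X _ (J.toLinearMap.lTensor X d)) g = J (toOp _ _ (algMap X W d) g) := by
    intro d g
    induction d using TensorProduct.induction_on with
    | zero => simp
    | add a b ha hb => simp only [map_add, add_apply, ha, hb]
    | tmul x w => simp
  obtain ⟨φ, h1, h2⟩ := exists_factor (algMap X W)
    (Ψ.toLinearMap ∘ₗ algMap X _ ∘ₗ J.toLinearMap.lTensor X) ‖Ψ‖ (norm_nonneg _)
    (fun d => (le_abs_self _).trans ((Ψ.le_opNorm _).trans (by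
      gcongr
      refine eps_norm_le _ _ (norm_nonneg _) fun g => ?_
      refine (le_of_eq (congrArg norm (id1 d g))).trans ?_
      exact (double_dual_bound ℝ W _).trans (toOp_le _ _))))
  exact ⟨φ, h2, fun x w => h1 (x ⊗ₜ w)⟩

lemma extend_bidual (φ : StrongDual ℝ (EpsTensor X W)) (S : X →L[ℝ] StrongDual ℝ W)
    (hS : ∀ x w, S x w = φ (tmulEps x w)) :
    ∃ Ψ : StrongDual ℝ (EpsTensor X (StrongDual ℝ (StrongDual ℝ W))), ‖Ψ‖ ≤ ‖φ‖ ∧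
      ∀ x f, Ψ (tmulEps x f) = f (S x) := by
  let β : X ⊗[ℝ] StrongDual ℝ (StrongDual ℝ W) →ₗ[ℝ] ℝ :=
    TensorProduct.lift (LinearMap.mk₂ ℝ (fun x f => f (S x))
      (fun a b f => by simp) (fun c a f => by simp)
      (fun a f f' => by simp) (fun c a f => by simp))
  have hβ : ∀ x f, β (x ⊗ₜ f) = f (S x) := fun x f => rfl
  have hS' : ∀ x, φ.comp (tmulLeft x) = S x := by
    intro x
    ext w
    rw [hS]
    rfl
  obtain ⟨Ψ, h1, h2⟩ := exists_factor (algMap X (StrongDual ℝ (StrongDual ℝ W))) β ‖φ‖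
    (norm_nonneg _) (by
      intro d
      obtain ⟨s, rfl⟩ := TensorProduct.exists_finset d
      have := bidual_bound φ (fun i : s => i.1.1) (fun i : s => i.1.2)
      simp only [hS'] at this
      simp only [map_sum, hβ, algMap_tmul]
      rw [Finset.sum_coe_sort s (fun i => i.2 (S i.1)),
        Finset.sum_coe_sort s (fun i => tmulEps i.1 i.2)] at this
      exact this)
  exact ⟨Ψ, h2, fun x f => h1 (x ⊗ₜ f)⟩

end Bidual

section Final

variable {X Y Z : Type} [NormedAddCommGroup X] [NormedSpace ℝ X]
  [NormedAddCommGroup Y] [NormedSpace ℝ Y] [NormedAddCommGroup Z] [NormedSpace ℝ Z]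

lemma backward (T : EpsTensor X Y →L[ℝ] Z)
    (S : X →L[ℝ] StrongDual ℝ (EpsTensor Y (StrongDual ℝ Z)))
    (hS : ∀ (x : X) (y : Y) (z : StrongDual ℝ Z), S x (tmulEps y z) = z (T (tmulEps x y)))
    (Ψ : StrongDual ℝ (EpsTensor X (StrongDual ℝ (StrongDual ℝ (EpsTensor Y (StrongDual ℝ Z))))))
    (hΨ : ExtendsOf S Ψ) : ∃ Φ, ExtendsOf T Φ ∧ ‖Φ‖ ≤ ‖Ψ‖ := by
  obtain ⟨φ, h1, h2⟩ := restrict_bidual Ψ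
  obtain ⟨Φ, h3, h4⟩ := transfer_rl φ
  refine ⟨Φ, fun u z => ?_, h3.trans h1⟩
  let R : EpsTensor X Y →L[ℝ] EpsTensor (EpsTensor X Y) (StrongDual ℝ Z) :=
    ((tmulBil (EpsTensor X Y) (StrongDual ℝ Z)).flip z).mkContinuous ‖z‖
      (fun u => (norm_tmul_le u z).trans (le_of_eq (mul_comm _ _)))
  have : Φ.comp R = z.comp T := by
    refine eps_ext _ _ fun x y => ?_
    change Φ (tmulEps (tmulEps x y) z) = z (T (tmulEps x y))
    rw [h4, h2, hΨ, ← hS]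
    rfl
  exact congrArg (fun F => F u) this

lemma forward_phi (T : EpsTensor X Y →L[ℝ] Z)
    (Φ : StrongDual ℝ (EpsTensor (EpsTensor X Y) (StrongDual ℝ Z))) (hΦ : ExtendsOf T Φ) :
    ∃ φ : StrongDual ℝ (EpsTensor X (EpsTensor Y (StrongDual ℝ Z))), ‖φ‖ ≤ ‖Φ‖ ∧
      ∀ x y z, φ (tmulEps x (tmulEps y z)) = z (T (tmulEps x y)) := by
  obtain ⟨φ, h1, h2⟩ := transfer_lr Φ
  exact ⟨φ, h1, fun x y z => by rw [h2, hΦ]⟩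

lemma forward (T : EpsTensor X Y →L[ℝ] Z)
    (S : X →L[ℝ] StrongDual ℝ (EpsTensor Y (StrongDual ℝ Z)))
    (hS : ∀ (x : X) (y : Y) (z : StrongDual ℝ Z), S x (tmulEps y z) = z (T (tmulEps x y)))
    (Φ : StrongDual ℝ (EpsTensor (EpsTensor X Y) (StrongDual ℝ Z))) (hΦ : ExtendsOf T Φ) :
    ∃ Ψ, ExtendsOf S Ψ ∧ ‖Ψ‖ ≤ ‖Φ‖ := by
  obtain ⟨φ, h1, h2⟩ := forward_phi T Φ hΦ
  obtain ⟨Ψ, h3, h4⟩ := extend_bidual φ S (fun x w => by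
    have : S x = φ.comp (tmulLeft x) := by
      refine eps_ext _ _ fun y z => ?_
      rw [hS, ← h2]
      rfl
    rw [this]
    rfl)
  exact ⟨Ψ, h4, h3.trans h1⟩

lemma exists_sharp (T : EpsTensor X Y →L[ℝ] Z) (hT : IsIntegralOp T) :
    ∃ S : X →L[ℝ] StrongDual ℝ (EpsTensor Y (StrongDual ℝ Z)),
      (∀ (x : X) (y : Y) (z : StrongDual ℝ Z), S x (tmulEps y z) = z (T (tmulEps x y))) ∧
      ∀ x, S x ∈ IntegralSub Y Z := by
  obtain ⟨Φ, hΦ⟩ := hT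
  obtain ⟨φ, -, h2⟩ := forward_phi T Φ hΦ
  let B := (tmulBil X (EpsTensor Y (StrongDual ℝ Z))).compr₂ φ.toLinearMap
  let S : X →L[ℝ] StrongDual ℝ (EpsTensor Y (StrongDual ℝ Z)) :=
    B.mkContinuous₂ ‖φ‖ (fun x w => by
      refine (φ.le_opNorm _).trans ?_
      rw [mul_assoc]
      gcongr
      exact norm_tmul_le x w)
  have hS : ∀ (x : X) (y : Y) (z : StrongDual ℝ Z),
      S x (tmulEps y z) = z (T (tmulEps x y)) := fun x y z => h2 x y z
  exact ⟨S, hS, fun x => ⟨sharp T x, fun y z => hS x y z⟩⟩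

end Final

end Helpers

/-- Theorem 2: for Banach spaces `X, Y, Z` and a bounded linear operator
`T : X ⊗̂_ε Y → Z`, `T` is integral if and only if `î ∘ T# : X → I(Y, Z**)` is integral, and in
that case `‖î ∘ T#‖_int = ‖T‖_int`.  Here `I(Y, Z**)` is identified isometrically with the dual
`(Y ⊗̂_ε Z*)*`, and the operator `S = î ∘ T#` is the (unique) bounded operator determined by
`(S x)(y ⊗ z*) = z*(T (x ⊗ y))`; the fact that `S x = î (T# x)` with `T# x ∈ I(Y,Z)` is
expressed by the membership `S x ∈ IntegralSub Y Z`. -/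
theorem statement1 (X Y Z : Type)
    [NormedAddCommGroup X] [NormedSpace ℝ X] [CompleteSpace X]
    [NormedAddCommGroup Y] [NormedSpace ℝ Y] [CompleteSpace Y]
    [NormedAddCommGroup Z] [NormedSpace ℝ Z] [CompleteSpace Z]
    (T : EpsTensor X Y →L[ℝ] Z) :
    (IsIntegralOp T ↔
      ∃ S : X →L[ℝ] StrongDual ℝ (EpsTensor Y (StrongDual ℝ Z)),
        (∀ (x : X) (y : Y) (z : StrongDual ℝ Z),
            S x (tmulEps y z) = z (T (tmulEps x y))) ∧
        (∀ x : X, S x ∈ IntegralSub Y Z) ∧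
        IsIntegralOp S) ∧
    (∀ S : X →L[ℝ] StrongDual ℝ (EpsTensor Y (StrongDual ℝ Z)),
      (∀ (x : X) (y : Y) (z : StrongDual ℝ Z),
          S x (tmulEps y z) = z (T (tmulEps x y))) →
      (∀ x : X, S x ∈ IntegralSub Y Z) →
      IsIntegralOp S →
      integralNorm S = integralNorm T) := by
  refine ⟨⟨fun hT => ?_, ?_⟩, ?_⟩
  · obtain ⟨S, hS, hmem⟩ := exists_sharp T hT
    obtain ⟨Φ, hΦ⟩ := hT
    obtain ⟨Ψ, hΨ, -⟩ := forward T S hS Φ hΦ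
    exact ⟨S, hS, hmem, Ψ, hΨ⟩
  · rintro ⟨S, hS, -, Ψ, hΨ⟩
    obtain ⟨Φ, hΦ, -⟩ := backward T S hS Ψ hΨ
    exact ⟨Φ, hΦ⟩
  · rintro S hS - ⟨Ψ₀, hΨ₀⟩
    obtain ⟨Φ₀, hΦ₀, -⟩ := backward T S hS Ψ₀ hΨ₀
    unfold integralNorm
    apply le_antisymm
    · refine le_csInf ⟨_, Φ₀, hΦ₀, rfl⟩ ?_
      rintro _ ⟨Φ, hΦ, rfl⟩
      obtain ⟨Ψ, hΨ, hle⟩ := forward T S hS Φ hΦ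
      have hbdd : BddBelow {c | ∃ Φ, ExtendsOf S Φ ∧ ‖Φ‖ = c} := by
        refine ⟨0, ?_⟩
        rintro _ ⟨_, -, rfl⟩
        exact norm_nonneg _
      exact (csInf_le hbdd ⟨Ψ, hΨ, rfl⟩).trans hle
    · refine le_csInf ⟨_, Ψ₀, hΨ₀, rfl⟩ ?_
      rintro _ ⟨Ψ, hΨ, rfl⟩
      obtain ⟨Φ, hΦ, hle⟩ := backward T S hS Ψ hΨ
      have hbdd : BddBelow {c | ∃ Φ, ExtendsOf T Φ ∧ ‖Φ‖ = c} := by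
        refine ⟨0, ?_⟩
        rintro _ ⟨_, -, rfl⟩
        exact norm_nonneg _
      exact (csInf_le hbdd ⟨Φ, hΦ, rfl⟩).trans hle
end
end

section
/- Let X, Y and Z be Banach spaces and let T : X ⊗̂_ε Y → Z be a bounded linear operator. If T# maps X into I(Y,Z) and T# : X → I(Y,Z) is an integral operator, then T : X ⊗̂_ε Y → Z is an integral operator. -/
set_option maxHeartbeats 1000000
set_option synthInstance.maxHeartbeats 400000
set_option maxSynthPendingDepth 3

noncomputable section

open scoped BigOperators NNReal ENNReal
open NormedSpace

section Helpers

variable {E F : Type} [NormedAddCommGroup E] [NormedSpace ℝ E]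
  [NormedAddCommGroup F] [NormedSpace ℝ F]

/-- The inclusion of the injective tensor product into the space of operators. -/
def epsIncl (E F : Type) [NormedAddCommGroup E] [NormedSpace ℝ E]
    [NormedAddCommGroup F] [NormedSpace ℝ F] :
    EpsTensor E F →L[ℝ] (StrongDual ℝ E →L[ℝ] F) :=
  (epsSub E F).subtypeL

theorem epsIncl_norm (u : EpsTensor E F) : ‖epsIncl E F u‖ = ‖u‖ := rfl

theorem epsIncl_injective : Function.Injective (epsIncl E F) := Subtype.val_injective

theorem epsIncl_tmul (e : E) (f : F) (x : StrongDual ℝ E) :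
    epsIncl E F (tmulEps e f) x = x e • f := rfl

/-- A closed submodule containing all elementary tensors is everything. -/
theorem eps_closed_mem (p : Submodule ℝ (EpsTensor E F)) (hp : IsClosed (p : Set (EpsTensor E F)))
    (h : ∀ e f, tmulEps e f ∈ p) (u : EpsTensor E F) : u ∈ p := by
  have h1 : ∀ v (hv : v ∈ Submodule.span ℝ (Set.range fun p : E × F => elemTensor p.1 p.2)),
      (show EpsTensor E F from (⟨v, Submodule.le_topologicalClosure _ hv⟩ : ↥(epsSub E F))) ∈ p := by
    intro v hv
    induction hv using Submodule.span_induction with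
    | mem x hx =>
      obtain ⟨⟨a, b⟩, rfl⟩ := hx
      exact h a b
    | zero => exact p.zero_mem
    | add x y hx hy ihx ihy => exact p.add_mem ihx ihy
    | smul c x hx ih => exact p.smul_mem c ih
  have h2 : (epsIncl E F u) ∈ closure
      ((Submodule.span ℝ (Set.range fun p : E × F => elemTensor p.1 p.2) :
        Submodule ℝ (StrongDual ℝ E →L[ℝ] F)) : Set (StrongDual ℝ E →L[ℝ] F)) := u.2
  rw [← SetLike.mem_coe, ← hp.closure_eq, Metric.mem_closure_iff]
  intro ε hε
  obtain ⟨v, hv, hd⟩ := Metric.mem_closure_iff.1 h2 ε hε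
  exact ⟨_, h1 v hv, hd⟩

theorem eps_clm_ext {G : Type*} [NormedAddCommGroup G] [NormedSpace ℝ G]
    (A B : EpsTensor E F →L[ℝ] G) (h : ∀ e f, A (tmulEps e f) = B (tmulEps e f)) : A = B := by
  ext u
  have := eps_closed_mem (LinearMap.ker ((A - B : EpsTensor E F →L[ℝ] G) : EpsTensor E F →ₗ[ℝ] G))
    (ContinuousLinearMap.isClosed_ker (A - B)) (fun e f => by simp [h]) u
  simpa [sub_eq_zero] using this

/-- `e ↦ e ⊗ f` as a bounded operator. -/
def tmulRight (f : F) : E →L[ℝ] EpsTensor E F :=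
  show E →L[ℝ] ↥(epsSub E F) from
    ContinuousLinearMap.codRestrict
      (((ContinuousLinearMap.smulRightL ℝ (StrongDual ℝ E) F).flip f).comp
        (inclusionInDoubleDual ℝ E))
      (epsSub E F)
      (fun e => Submodule.le_topologicalClosure _ (Submodule.subset_span ⟨(e, f), rfl⟩))

theorem tmulRight_apply (e : E) (f : F) : tmulRight f e = tmulEps e f := rfl

variable (X Y G : Type) [NormedAddCommGroup X] [NormedSpace ℝ X]
  [NormedAddCommGroup Y] [NormedSpace ℝ Y] [NormedAddCommGroup G] [NormedSpace ℝ G]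

/-- `(x*, y*) ↦ (u ↦ y* (u x*))`. -/
def dualTensor : StrongDual ℝ X →L[ℝ] StrongDual ℝ Y →L[ℝ] StrongDual ℝ (EpsTensor X Y) :=
  ((ContinuousLinearMap.compL ℝ (EpsTensor X Y) Y ℝ).flip).comp (epsIncl X Y).flip

theorem dualTensor_apply (x : StrongDual ℝ X) (y : StrongDual ℝ Y) (u : EpsTensor X Y) :
    dualTensor X Y x y u = y (epsIncl X Y u x) := rfl

/-- Uncurrying on the level of operators. -/
def assocOp : EpsTensor (EpsTensor X Y) G →L[ℝ]
    StrongDual ℝ X →L[ℝ] StrongDual ℝ Y →L[ℝ] G :=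
  (((ContinuousLinearMap.compL ℝ (StrongDual ℝ X)
      (StrongDual ℝ Y →L[ℝ] StrongDual ℝ (EpsTensor X Y)) (StrongDual ℝ Y →L[ℝ] G)).flip
        (dualTensor X Y)).comp
    (ContinuousLinearMap.compL ℝ (StrongDual ℝ Y) (StrongDual ℝ (EpsTensor X Y)) G)).comp
    (epsIncl (EpsTensor X Y) G)

theorem assocOp_apply (U : EpsTensor (EpsTensor X Y) G) (x : StrongDual ℝ X)
    (y : StrongDual ℝ Y) :
    assocOp X Y G U x y = epsIncl _ _ U (dualTensor X Y x y) := rfl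

theorem assocOp_tmul (u : EpsTensor X Y) (g : G) (x : StrongDual ℝ X) :
    assocOp X Y G (tmulEps u g) x = epsIncl Y G (tmulEps (epsIncl X Y u x) g) := by
  ext y
  rw [assocOp_apply, epsIncl_tmul, epsIncl_tmul, dualTensor_apply]

theorem assocOp_mem (U : EpsTensor (EpsTensor X Y) G) (x : StrongDual ℝ X) :
    assocOp X Y G U x ∈ epsSub Y G := by
  let B : EpsTensor (EpsTensor X Y) G →L[ℝ] (StrongDual ℝ Y →L[ℝ] G) := (assocOp X Y G).flip x
  have hc : IsClosed ((epsSub Y G : Submodule ℝ (StrongDual ℝ Y →L[ℝ] G)) :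
      Set (StrongDual ℝ Y →L[ℝ] G)) := Submodule.isClosed_topologicalClosure _
  refine eps_closed_mem ((epsSub Y G).comap B.toLinearMap) (hc.preimage B.continuous) ?_ U
  intro u g
  change assocOp X Y G (tmulEps u g) x ∈ epsSub Y G
  rw [assocOp_tmul]
  exact (tmulEps (epsIncl X Y u x) g).2

/-- The operator with values in the injective tensor product. -/
def assocOp2 : EpsTensor (EpsTensor X Y) G →L[ℝ] StrongDual ℝ X →L[ℝ] EpsTensor Y G :=
  LinearMap.mkContinuous
    { toFun := fun U => show StrongDual ℝ X →L[ℝ] ↥(epsSub Y G) from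
        ContinuousLinearMap.codRestrict (assocOp X Y G U) (epsSub Y G) (assocOp_mem X Y G U)
      map_add' := fun U V => by
        refine ContinuousLinearMap.ext fun x => ?_
        apply epsIncl_injective
        change assocOp X Y G (U + V) x = assocOp X Y G U x + assocOp X Y G V x
        simp
      map_smul' := fun c U => by
        refine ContinuousLinearMap.ext fun x => ?_
        apply epsIncl_injective
        change assocOp X Y G (c • U) x = c • assocOp X Y G U x
        simp }
    ‖assocOp X Y G‖
    (fun U => ContinuousLinearMap.opNorm_le_bound _ (by positivity)
      (fun x => (assocOp X Y G).le_opNorm₂ U x))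

theorem assocOp2_incl (U : EpsTensor (EpsTensor X Y) G) (x : StrongDual ℝ X) :
    epsIncl Y G (assocOp2 X Y G U x) = assocOp X Y G U x := rfl

theorem assocOp2_tmul (u : EpsTensor X Y) (g : G) (x : StrongDual ℝ X) :
    assocOp2 X Y G (tmulEps u g) x = tmulEps (epsIncl X Y u x) g := by
  apply epsIncl_injective
  rw [assocOp2_incl, assocOp_tmul]

variable {X Y G}

/-- Composition with an operator out of `Y ⊗ G`. -/
def assocOp3 {H : Type} [NormedAddCommGroup H] [NormedSpace ℝ H] (j : EpsTensor Y G →L[ℝ] H) :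
    EpsTensor (EpsTensor X Y) G →L[ℝ] StrongDual ℝ X →L[ℝ] H :=
  (ContinuousLinearMap.compL ℝ (StrongDual ℝ X) (EpsTensor Y G) H j).comp (assocOp2 X Y G)

theorem assocOp3_apply {H : Type} [NormedAddCommGroup H] [NormedSpace ℝ H]
    (j : EpsTensor Y G →L[ℝ] H) (U : EpsTensor (EpsTensor X Y) G) (x : StrongDual ℝ X) :
    assocOp3 j U x = j (assocOp2 X Y G U x) := rfl

theorem assocOp3_tmul {H : Type} [NormedAddCommGroup H] [NormedSpace ℝ H]
    (j : EpsTensor Y G →L[ℝ] H) (x : X) (y : Y) (g : G) :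
    assocOp3 j (tmulEps (tmulEps x y) g) = epsIncl X H (tmulEps x (j (tmulEps y g))) := by
  ext f
  rw [assocOp3_apply, assocOp2_tmul, epsIncl_tmul, epsIncl_tmul, ← tmulRight_apply, map_smul,
    map_smul, tmulRight_apply]

theorem assocOp3_mem {H : Type} [NormedAddCommGroup H] [NormedSpace ℝ H]
    (j : EpsTensor Y G →L[ℝ] H) (U : EpsTensor (EpsTensor X Y) G) :
    assocOp3 j U ∈ epsSub X H := by
  have hc : IsClosed ((epsSub X H : Submodule ℝ (StrongDual ℝ X →L[ℝ] H)) :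
      Set (StrongDual ℝ X →L[ℝ] H)) := Submodule.isClosed_topologicalClosure _
  refine eps_closed_mem ((epsSub X H).comap
    (assocOp3 (X := X) j).toLinearMap)
    (hc.preimage (assocOp3 (X := X) j).continuous) ?_ U
  intro u g
  let B : EpsTensor X Y →L[ℝ] (StrongDual ℝ X →L[ℝ] H) := (assocOp3 j).comp (tmulRight g)
  refine eps_closed_mem ((epsSub X H).comap B.toLinearMap)
    (hc.preimage B.continuous) ?_ u
  intro x y
  change assocOp3 j (tmulEps (tmulEps x y) g) ∈ epsSub X H
  rw [assocOp3_tmul]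
  exact (tmulEps x (j (tmulEps y g))).2

/-- The associativity map `(X ⊗ Y) ⊗ G → X ⊗ (Y ⊗ G) → X ⊗ H`. -/
def assocMap {H : Type} [NormedAddCommGroup H] [NormedSpace ℝ H] (j : EpsTensor Y G →L[ℝ] H) :
    EpsTensor (EpsTensor X Y) G →L[ℝ] EpsTensor X H :=
  show EpsTensor (EpsTensor X Y) G →L[ℝ] ↥(epsSub X H) from
    ContinuousLinearMap.codRestrict (assocOp3 j) (epsSub X H) (assocOp3_mem j)

theorem assocMap_tmul {H : Type} [NormedAddCommGroup H] [NormedSpace ℝ H]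
    (j : EpsTensor Y G →L[ℝ] H) (x : X) (y : Y) (g : G) :
    assocMap j (tmulEps (tmulEps x y) g) = tmulEps x (j (tmulEps y g)) :=
  epsIncl_injective (assocOp3_tmul j x y g)

/-- Evaluation of integral functionals. -/
def evalInt (Y Z : Type) [NormedAddCommGroup Y] [NormedSpace ℝ Y]
    [NormedAddCommGroup Z] [NormedSpace ℝ Z] :
    EpsTensor Y (StrongDual ℝ Z) →L[ℝ] StrongDual ℝ (IntegralSpace Y Z) :=
  ContinuousLinearMap.flip
    (show IntegralSpace Y Z →L[ℝ] StrongDual ℝ (EpsTensor Y (StrongDual ℝ Z)) from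
      (IntegralSub Y Z).subtypeL)

theorem evalInt_apply {Y Z : Type} [NormedAddCommGroup Y] [NormedSpace ℝ Y]
    [NormedAddCommGroup Z] [NormedSpace ℝ Z] (w : EpsTensor Y (StrongDual ℝ Z))
    (Φ : IntegralSpace Y Z) : evalInt Y Z w Φ = Φ.toFunctional w := rfl

end Helpers

/-- Theorem 2, last assertion: if `T# : X → I(Y,Z)` is (well defined and)
integral, then `T : X ⊗̂_ε Y → Z` is integral.  Here `I(Y,Z)` with the integral norm is realized
isometrically as the subspace `IntegralSub Y Z` of `(Y ⊗̂_ε Z*)*`, and the hypothesis that the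
operator `S : X → I(Y,Z)` is `T#` is expressed by `(S x)(y ⊗ z*) = z*(T (x ⊗ y))`. -/
theorem statement2 (X Y Z : Type)
    [NormedAddCommGroup X] [NormedSpace ℝ X] [CompleteSpace X]
    [NormedAddCommGroup Y] [NormedSpace ℝ Y] [CompleteSpace Y]
    [NormedAddCommGroup Z] [NormedSpace ℝ Z] [CompleteSpace Z]
    (T : EpsTensor X Y →L[ℝ] Z)
    (S : X →L[ℝ] IntegralSpace Y Z)
    (hS : ∀ (x : X) (y : Y) (z : StrongDual ℝ Z),
        (S x).toFunctional (tmulEps y z) = z (T (tmulEps x y)))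
    (hint : IsIntegralOp S) :
    IsIntegralOp T := by
  obtain ⟨Φ, hΦ⟩ := hint
  refine ⟨Φ.comp (assocMap (evalInt Y Z)), fun u z => ?_⟩
  have key : (Φ.comp (assocMap (evalInt Y Z))).comp (tmulRight z) = z.comp T := by
    apply eps_clm_ext
    intro x y
    change Φ (assocMap (evalInt Y Z) (tmulEps (tmulEps x y) z)) = z (T (tmulEps x y))
    rw [assocMap_tmul, hΦ, evalInt_apply, hS]
  exact congrArg (fun L : StrongDual ℝ (EpsTensor X Y) => L u) key
end
end

section
/- Let X, Y and Z be Banach spaces and let T : X ⊗̂_ε Y → Z be an integral operator. Then for every x ∈ X, the operator T# x : Y → Z is integral with ‖T# x‖_int ≤ ‖x‖ · ‖T‖_int. -/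
set_option maxHeartbeats 1000000
set_option synthInstance.maxHeartbeats 400000
set_option maxSynthPendingDepth 3

noncomputable section

open scoped BigOperators NNReal ENNReal
open NormedSpace

section Aux

variable {Y E W : Type} [NormedAddCommGroup Y] [NormedSpace ℝ Y]
  [NormedAddCommGroup E] [NormedSpace ℝ E] [NormedAddCommGroup W] [NormedSpace ℝ W]

/-- The adjoint `f ↦ f ∘ S`. -/
def dualOp (S : Y →L[ℝ] E) : StrongDual ℝ E →L[ℝ] StrongDual ℝ Y :=
  (ContinuousLinearMap.compL ℝ Y E ℝ).flip S

/-- Precomposition with the adjoint of `S`. -/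
def preDual (S : Y →L[ℝ] E) :
    (StrongDual ℝ Y →L[ℝ] W) →L[ℝ] (StrongDual ℝ E →L[ℝ] W) :=
  (ContinuousLinearMap.compL ℝ (StrongDual ℝ E) (StrongDual ℝ Y) W).flip (dualOp S)

lemma dualOp_norm (S : Y →L[ℝ] E) : ‖dualOp S‖ ≤ ‖S‖ := by
  refine ContinuousLinearMap.opNorm_le_bound _ (norm_nonneg _) fun f => ?_
  rw [mul_comm]
  exact ContinuousLinearMap.opNorm_comp_le f S

lemma preDual_norm_le (S : Y →L[ℝ] E) (u : StrongDual ℝ Y →L[ℝ] W) :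
    ‖preDual S u‖ ≤ ‖S‖ * ‖u‖ := by
  rw [mul_comm]
  exact (ContinuousLinearMap.opNorm_comp_le u (dualOp S)).trans
    (mul_le_mul_of_nonneg_left (dualOp_norm S) (norm_nonneg _))

lemma preDual_elem (S : Y →L[ℝ] E) (y : Y) (w : W) :
    preDual S (elemTensor y w) = elemTensor (S y) w := by
  ext f
  rfl

lemma preDual_mem (S : Y →L[ℝ] E) (u : StrongDual ℝ Y →L[ℝ] W) (hu : u ∈ epsSub Y W) :
    preDual S u ∈ epsSub E W := by
  refine map_mem_closure (preDual S).continuous hu ?_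
  intro v hv
  change v ∈ (Submodule.span ℝ _).comap (preDual S).toLinearMap
  refine (Submodule.span_le.mpr ?_) hv
  rintro _ ⟨p, rfl⟩
  exact Submodule.subset_span ⟨(S p.1, p.2), (preDual_elem S p.1 p.2).symm⟩

/-- `S ⊗ id : Y ⊗̂_ε W → E ⊗̂_ε W`. -/
def epsMap (S : Y →L[ℝ] E) : EpsTensor Y W →L[ℝ] EpsTensor E W :=
  show ↥(epsSub Y W) →L[ℝ] ↥(epsSub E W) from
    ContinuousLinearMap.codRestrict ((preDual S).comp (epsSub Y W).subtypeL) (epsSub E W)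
      (fun u => preDual_mem S u.1 u.2)

lemma epsMap_norm (S : Y →L[ℝ] E) : ‖(epsMap S : EpsTensor Y W →L[ℝ] EpsTensor E W)‖ ≤ ‖S‖ :=
  ContinuousLinearMap.opNorm_le_bound _ (norm_nonneg _)
    fun u => preDual_norm_le S (Subtype.val u)

lemma epsMap_tmul (S : Y →L[ℝ] E) (y : Y) (w : W) :
    epsMap S (tmulEps y w) = tmulEps (S y) w :=
  Subtype.ext (preDual_elem S y w)

lemma tmulLeft_norm (x : E) : ‖(tmulLeft x : W →L[ℝ] EpsTensor E W)‖ ≤ ‖x‖ := by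
  refine ContinuousLinearMap.opNorm_le_bound _ (norm_nonneg _) fun w => ?_
  change ‖(inclusionInDoubleDual ℝ E x).smulRight w‖ ≤ _
  rw [ContinuousLinearMap.norm_smulRight_apply]
  exact mul_le_mul_of_nonneg_right (double_dual_bound ℝ E x) (norm_nonneg _)

end Aux

/-- if `T : X ⊗̂_ε Y → Z` is an integral operator, then for every `x ∈ X` the
operator `T# x : Y → Z`, `(T# x) y = T (x ⊗ y)`, is integral, with
`‖T# x‖_int ≤ ‖x‖ · ‖T‖_int`. -/
theorem statement4 (X Y Z : Type)
    [NormedAddCommGroup X] [NormedSpace ℝ X] [CompleteSpace X]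
    [NormedAddCommGroup Y] [NormedSpace ℝ Y] [CompleteSpace Y]
    [NormedAddCommGroup Z] [NormedSpace ℝ Z] [CompleteSpace Z]
    (T : EpsTensor X Y →L[ℝ] Z) (hT : IsIntegralOp T) (x : X) :
    IsIntegralOp (sharp T x) ∧
      integralNorm (sharp T x) ≤ ‖x‖ * integralNorm T := by
  have key : ∀ Φ, ExtendsOf T Φ →
      ExtendsOf (sharp T x) (Φ.comp (epsMap (tmulLeft x))) := by
    intro Φ hΦ y f
    rw [ContinuousLinearMap.comp_apply, epsMap_tmul, hΦ]
    rfl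
  obtain ⟨Φ₀, h₀⟩ := hT
  refine ⟨⟨_, key Φ₀ h₀⟩, ?_⟩
  have bound : ∀ Φ, ExtendsOf T Φ → integralNorm (sharp T x) ≤ ‖x‖ * ‖Φ‖ := by
    intro Φ hΦ
    have h1 : integralNorm (sharp T x) ≤ ‖Φ.comp (epsMap (tmulLeft x))‖ := by
      refine csInf_le ⟨0, ?_⟩ ⟨_, key Φ hΦ, rfl⟩
      rintro _ ⟨Ψ, -, rfl⟩
      exact norm_nonneg Ψ
    refine h1.trans ((ContinuousLinearMap.opNorm_comp_le _ _).trans ?_)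
    rw [mul_comm]
    exact mul_le_mul_of_nonneg_right ((epsMap_norm _).trans (tmulLeft_norm x)) (norm_nonneg _)
  rcases (norm_nonneg x).eq_or_lt with hx | hx
  · have := bound Φ₀ h₀
    rw [← hx, zero_mul] at this ⊢
    exact this
  · rw [← div_le_iff₀' hx]
    refine le_csInf ⟨_, Φ₀, h₀, rfl⟩ ?_
    rintro _ ⟨Ψ, hΨ, rfl⟩
    rw [div_le_iff₀' hx]
    exact bound Ψ hΨ
end
end
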